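/- The complex vector space of cusp forms of weight 6 for Γ₀(4) is one-dimensional. -/

import Mathlib

open MatrixGroups CongruenceSubgroup

section EtaPow

open UpperHalfPlane ModularForm ModularGroup Filter Asymptotics
open scoped Real Pointwise

/-- The restriction of a cusp form to a smaller group. -/
def CuspForm.restrictLevel {𝒢 ℋ : Subgroup (GL (Fin 2) ℝ)} {k : ℤ} (h : ℋ ≤ 𝒢)
    (f : CuspForm 𝒢 k) : CuspForm ℋ k where
  toFun := f
  slash_action_eq' γ hγ := f.slash_action_eq' γ (h hγ)
  holo' := f.holo'
  zero_at_cusps' hc := f.zero_at_cusps' (hc.mono h)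

/-- The twelfth power of the Dedekind eta function, as a function on the upper half-plane. -/
noncomputable def etaPowTwelve (z : ℍ) : ℂ := ModularForm.eta z ^ 12

lemma etaPowTwelve_sq (z : ℍ) : etaPowTwelve z ^ 2 = ModularForm.discriminant z := by
  rw [etaPowTwelve, ModularForm.discriminant, ← pow_mul]

lemma etaPowTwelve_ne_zero (z : ℍ) : etaPowTwelve z ≠ 0 :=
  pow_ne_zero _ (eta_ne_zero z.2)

lemma mdifferentiable_etaPowTwelve :
    MDifferentiable (modelWithCornersSelf ℂ ℂ) (modelWithCornersSelf ℂ ℂ) etaPowTwelve := by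
  rw [UpperHalfPlane.mdifferentiable_iff]
  refine .congr (fun z hz ↦ (differentiableAt_eta_of_mem_upperHalfPlaneSet hz).pow
    12 |>.differentiableWithinAt) fun z hz ↦ ?_
  simp [etaPowTwelve, ofComplex_apply_of_im_pos hz]

lemma isZeroAtImInfty_etaPowTwelve : IsZeroAtImInfty etaPowTwelve := by
  have h := discriminant_isZeroAtImInfty
  rw [IsZeroAtImInfty, ZeroAtFilter, tendsto_zero_iff_norm_tendsto_zero] at h ⊢
  have h' := h.sqrt
  rw [Real.sqrt_zero] at h'
  refine h'.congr fun z ↦ ?_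
  rw [← etaPowTwelve_sq, norm_pow, Real.sqrt_sq (norm_nonneg _)]

lemma exp_isBigO_etaPowTwelve :
    (fun τ : ℍ ↦ Real.exp (-π * τ.im)) =O[atImInfty] etaPowTwelve := by
  refine IsBigO.of_pow (n := 2) two_ne_zero ?_
  refine (exp_isBigO_discriminant.congr (fun τ ↦ ?_) fun τ ↦ ?_)
  · rw [Pi.pow_apply, ← Real.exp_nat_mul]
    push_cast
    ring_nf
  · rw [Pi.pow_apply, etaPowTwelve_sq]

lemma etaPowTwelve_slash_T : etaPowTwelve ∣[(6 : ℤ)] T = -etaPowTwelve := by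
  ext z
  rw [SL_slash_apply, denom_apply, modular_T_smul]
  have hq : Function.Periodic.qParam 24 (1 + z : ℂ) ^ 12 =
      -Function.Periodic.qParam 24 z ^ 12 := by
    simp only [Function.Periodic.qParam, ← Complex.exp_nat_mul]
    rw [← mul_neg_one, ← Complex.exp_pi_mul_I, ← Complex.exp_add]
    congr 1
    push_cast
    ring
  have he (n : ℕ) : eta_q n (1 + z : ℂ) = eta_q n z := by
    simp [eta_q, Function.Periodic.qParam, mul_add, Complex.exp_add]
  simp [coe_T, etaPowTwelve, eta, mul_pow, hq, he]

lemma etaPowTwelve_slash_S : etaPowTwelve ∣[(6 : ℤ)] S = -etaPowTwelve := by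
  ext z
  have hsq {w : ℂ} (hw : w ≠ 0) : Complex.sqrt w ^ 12 = w ^ 6 := by
    rw [sqrt_eq_exp hw, ← Complex.exp_nat_mul]
    rw [show ((12 : ℕ) : ℂ) * (Complex.log w / 2) = (6 : ℕ) * Complex.log w by push_cast; ring,
      Complex.exp_nat_mul, Complex.exp_log hw]
  have he : η (-(z : ℂ)⁻¹) = (Complex.sqrt Complex.I)⁻¹ * (Complex.sqrt z * η z) := by
    simpa [neg_div] using eta_comp_eq_csqrt_I_inv z.2
  suffices η (-(z : ℂ)⁻¹) ^ 12 * ((z : ℂ) ^ 6)⁻¹ = -η z ^ 12 by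
    rw [SL_slash_apply, denom_apply, UpperHalfPlane.modular_S_smul]
    simpa [coe_S, etaPowTwelve, zpow_neg, zpow_ofNat] using this
  have hI : Complex.I ^ 6 = -1 := by
    rw [show 6 = 4 + 2 by rfl, pow_add, Complex.I_pow_four, Complex.I_sq, one_mul]
  rw [he, mul_pow, mul_pow, inv_pow, hsq Complex.I_ne_zero, hsq (ne_zero z), hI]
  field_simp [ne_zero z]

/-- The sign character of `SL(2, ℤ)`, obtained from the isomorphism of `SL(2, ℤ/2ℤ)` with the
symmetric group on three letters. -/
def signMod2 (γ : SL(2, ℤ)) : ℤ :=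
  if (γ 0 0 * γ 0 1 + γ 0 1 * γ 1 0 + γ 1 0 * γ 1 1 : ZMod 2) = 0 then 1 else -1

lemma signMod2_mul (γ δ : SL(2, ℤ)) : signMod2 (γ * δ) = signMod2 γ * signMod2 δ := by
  have key : ∀ a b c d a' b' c' d' : ZMod 2, a * d - b * c = 1 → a' * d' - b' * c' = 1 →
      (if (a * a' + b * c') * (a * b' + b * d') + (a * b' + b * d') * (c * a' + d * c')
          + (c * a' + d * c') * (c * b' + d * d') = 0 then (1 : ℤ) else -1) =
        (if a * b + b * c + c * d = 0 then 1 else -1) *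
        (if a' * b' + b' * c' + c' * d' = 0 then 1 else -1) := by
    decide
  have hdet (g : SL(2, ℤ)) : (g 0 0 * g 1 1 - g 0 1 * g 1 0 : ZMod 2) = 1 := by
    have := g.det_coe
    rw [Matrix.det_fin_two] at this
    exact_mod_cast congrArg (Int.cast : ℤ → ZMod 2) this
  simpa [signMod2, Matrix.mul_apply, Fin.sum_univ_two] using
    key _ _ _ _ _ _ _ _ (hdet γ) (hdet δ)

lemma signMod2_eq_one_of_mem_Gamma {γ : SL(2, ℤ)} (hγ : γ ∈ Gamma 2) : signMod2 γ = 1 := by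
  obtain ⟨-, h01, h10, -⟩ := Gamma_mem.mp hγ
  simp [signMod2, h01, h10]

lemma signMod2_eq_or (γ : SL(2, ℤ)) : signMod2 γ = 1 ∨ signMod2 γ = -1 := by
  unfold signMod2
  split_ifs <;> simp

lemma etaPowTwelve_slash (γ : SL(2, ℤ)) :
    etaPowTwelve ∣[(6 : ℤ)] γ = (signMod2 γ : ℂ) • etaPowTwelve := by
  have : γ ∈ Subgroup.closure {S, T} := by simp [SpecialLinearGroup.SL2Z_generators]
  induction this using Subgroup.closure_induction with
  | one => simp [signMod2]
  | mem g hg =>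
    rcases hg with rfl | rfl
    · rw [etaPowTwelve_slash_S]
      simp [signMod2, S]
    · rw [etaPowTwelve_slash_T]
      simp [signMod2, T]
  | mul g h _ _ hg hh =>
    rw [SlashAction.slash_mul, hg, SL_smul_slash, hh, smul_smul, signMod2_mul, Int.cast_mul]
  | inv g _ hg =>
    have h1 : etaPowTwelve ∣[(6 : ℤ)] (g * g⁻¹) =
        (signMod2 g : ℂ) • etaPowTwelve ∣[(6 : ℤ)] g⁻¹ := by
      rw [SlashAction.slash_mul, hg, SL_smul_slash]
    have h2 : signMod2 g * signMod2 g⁻¹ = 1 := by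
      rw [← signMod2_mul]
      simp [signMod2]
    rw [mul_inv_cancel, SlashAction.slash_one] at h1
    rw [h1, smul_smul, mul_comm, ← Int.cast_mul, h2, Int.cast_one, one_smul, ← h1]

/-- `η ^ 12` as a cusp form of weight `6` for `Γ(2)`. -/
noncomputable def CuspForm.etaPowTwelve : CuspForm (Gamma 2) 6 where
  toFun := _root_.etaPowTwelve
  slash_action_eq' := by
    rintro _ ⟨γ, hγ, rfl⟩
    have := etaPowTwelve_slash γ
    rwa [signMod2_eq_one_of_mem_Gamma hγ, Int.cast_one, one_smul] at this
  holo' := mdifferentiable_etaPowTwelve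
  zero_at_cusps' hc := by
    rw [Subgroup.IsArithmetic.isCusp_iff_isCusp_SL2Z] at hc
    rw [OnePoint.isZeroAt_iff_forall_SL2Z hc]
    intro γ _
    rw [etaPowTwelve_slash]
    exact isZeroAtImInfty_etaPowTwelve.smul _

lemma CuspForm.slash_isBigO_etaPowTwelve (f : CuspForm (Gamma 2) 6) (γ : SL(2, ℤ)) :
    (⇑f ∣[(6 : ℤ)] γ) =O[atImInfty] _root_.etaPowTwelve := by
  have hle : (Gamma 2 : Subgroup (GL (Fin 2) ℝ)) ≤
      ConjAct.toConjAct (γ : GL (Fin 2) ℝ)⁻¹ • (Gamma 2 : Subgroup (GL (Fin 2) ℝ)) := by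
    rintro _ ⟨δ, hδ, rfl⟩
    rw [Subgroup.mem_pointwise_smul_iff_inv_smul_mem, ← ConjAct.toConjAct_inv, inv_inv,
      ConjAct.toConjAct_smul]
    exact ⟨γ * δ * γ⁻¹, (Gamma_normal 2).conj_mem δ hδ γ, by rw [map_mul, map_mul, map_inv]; rfl⟩
  have h := CuspFormClass.exp_decay_atImInfty
    ((CuspForm.translate f (γ : GL (Fin 2) ℝ)).restrictLevel hle) two_pos (by simp)
  refine IsBigO.trans h (exp_isBigO_etaPowTwelve.congr_left fun τ ↦ ?_)
  ring_nf

lemma CuspForm.exists_smul_etaPowTwelve_eq (f : CuspForm (Gamma 2) 6) :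
    ∃ c : ℂ, c • _root_.etaPowTwelve = ⇑f := by
  have hslash (γ : SL(2, ℤ)) : (⇑f / _root_.etaPowTwelve) ∣[(0 : ℤ)] γ =
      (⇑f ∣[(6 : ℤ)] γ) / ((signMod2 γ : ℂ) • _root_.etaPowTwelve) := by
    rw [← etaPowTwelve_slash, ← div_slash_SL2, sub_self]
  let g : ModularForm (Gamma 2) 0 :=
    { toFun := ⇑f / _root_.etaPowTwelve
      slash_action_eq' := by
        rintro _ ⟨γ, hγ, rfl⟩
        have hf : ⇑f ∣[(6 : ℤ)] γ = ⇑f := f.slash_action_eq' _ ⟨γ, hγ, rfl⟩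
        have := hslash γ
        rwa [signMod2_eq_one_of_mem_Gamma hγ, Int.cast_one, one_smul, hf] at this
      holo' := f.holo'.div mdifferentiable_etaPowTwelve etaPowTwelve_ne_zero
      bdd_at_cusps' := fun {c} hc ↦ by
        rw [Subgroup.IsArithmetic.isCusp_iff_isCusp_SL2Z] at hc
        rw [OnePoint.isBoundedAt_iff_forall_SL2Z hc]
        intro γ _
        rw [hslash, IsBoundedAtImInfty, BoundedAtFilter]
        have hs : (signMod2 γ : ℂ) ≠ 0 := by
          rcases signMod2_eq_or γ with h | h <;> simp [h]
        exact (div_isBoundedUnder_of_isBigO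
          ((f.slash_isBigO_etaPowTwelve γ).trans
            (isBigO_self_const_mul hs _ _))).isBigO_one ℝ }
  obtain ⟨c, hc⟩ := g.eq_const_of_weight_zero
  refine ⟨c, funext fun z ↦ ?_⟩
  have hz : f z / _root_.etaPowTwelve z = c := congrFun hc z
  rw [Pi.smul_apply, smul_eq_mul, ← hz, div_mul_cancel₀ _ (etaPowTwelve_ne_zero z)]

/-- The matrix `diag(2, 1)`, which conjugates `Γ₀(4)` to `Γ(2)`. -/
noncomputable def diagTwoOne : GL (Fin 2) ℝ :=
  Matrix.GeneralLinearGroup.mkOfDetNeZero !![2, 0; 0, 1] (by simp)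

lemma sigma_diagTwoOne (c : ℂ) : σ diagTwoOne c = c := by
  simp [σ, diagTwoOne, Matrix.GeneralLinearGroup.mkOfDetNeZero]

lemma Gamma0_four_le_conj_Gamma_two : (Gamma0 4 : Subgroup (GL (Fin 2) ℝ)) ≤
    ConjAct.toConjAct diagTwoOne⁻¹ • (Gamma 2 : Subgroup (GL (Fin 2) ℝ)) := by
  rintro _ ⟨γ, hγ, rfl⟩
  rw [Subgroup.mem_pointwise_smul_iff_inv_smul_mem, ← ConjAct.toConjAct_inv, inv_inv,
    ConjAct.toConjAct_smul]
  have hγ' : ((γ 1 0 : ℤ) : ZMod 4) = 0 := Gamma0_mem.mp hγ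
  obtain ⟨m, hm⟩ : (4 : ℤ) ∣ γ 1 0 := (ZMod.intCast_zmod_eq_zero_iff_dvd _ 4).mp hγ'
  have hdet := γ.det_coe
  rw [Matrix.det_fin_two, hm] at hdet
  have hodd : Odd (γ 0 0 * γ 1 1) := ⟨2 * (γ 0 1 * m), by linarith⟩
  obtain ⟨h0, h1⟩ := Int.odd_mul.mp hodd
  obtain ⟨δ, hδ⟩ : ∃ δ : SL(2, ℤ), δ.val = !![γ 0 0, 2 * γ 0 1; 2 * m, γ 1 1] :=
    ⟨⟨_, by rw [Matrix.det_fin_two_of]; linarith⟩, rfl⟩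
  refine ⟨δ, Gamma_mem.mpr ⟨?_, ?_, ?_, ?_⟩, ?_⟩
  · rw [hδ]
    exact ZMod.intCast_eq_one_iff_odd.mpr h0
  · rw [hδ]
    exact (ZMod.intCast_zmod_eq_zero_iff_dvd _ 2).mpr ⟨_, rfl⟩
  · rw [hδ]
    exact (ZMod.intCast_zmod_eq_zero_iff_dvd _ 2).mpr ⟨_, rfl⟩
  · rw [hδ]
    exact ZMod.intCast_eq_one_iff_odd.mpr h1
  · rw [eq_mul_inv_iff_mul_eq]
    ext i j
    fin_cases i <;> fin_cases j <;>
      simp [diagTwoOne, Matrix.mul_apply, Fin.sum_univ_two, hδ, hm,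
        Matrix.GeneralLinearGroup.mkOfDetNeZero] <;> ring

lemma Gamma_two_le_conj_Gamma0_four : (Gamma 2 : Subgroup (GL (Fin 2) ℝ)) ≤
    ConjAct.toConjAct diagTwoOne⁻¹⁻¹ • (Gamma0 4 : Subgroup (GL (Fin 2) ℝ)) := by
  rintro _ ⟨γ, hγ, rfl⟩
  rw [inv_inv, Subgroup.mem_pointwise_smul_iff_inv_smul_mem, ← ConjAct.toConjAct_inv,
    ConjAct.toConjAct_smul, inv_inv]
  obtain ⟨-, h01, h10, -⟩ := Gamma_mem.mp hγ
  obtain ⟨b, hb⟩ : (2 : ℤ) ∣ γ 0 1 := (ZMod.intCast_zmod_eq_zero_iff_dvd _ 2).mp h01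
  obtain ⟨m, hm⟩ : (2 : ℤ) ∣ γ 1 0 := (ZMod.intCast_zmod_eq_zero_iff_dvd _ 2).mp h10
  have hdet := γ.det_coe
  rw [Matrix.det_fin_two, hm, hb] at hdet
  obtain ⟨δ, hδ⟩ : ∃ δ : SL(2, ℤ), δ.val = !![γ 0 0, b; 4 * m, γ 1 1] :=
    ⟨⟨_, by rw [Matrix.det_fin_two_of]; linarith⟩, rfl⟩
  refine ⟨δ, Gamma0_mem.mpr ?_, ?_⟩
  · rw [hδ]
    exact (ZMod.intCast_zmod_eq_zero_iff_dvd _ 4).mpr ⟨m, rfl⟩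
  · rw [mul_assoc, eq_inv_mul_iff_mul_eq]
    ext i j
    fin_cases i <;> fin_cases j <;>
      simp [diagTwoOne, Matrix.mul_apply, Fin.sum_univ_two, hδ, hm, hb,
        Matrix.GeneralLinearGroup.mkOfDetNeZero] <;> ring

/-- The cusp form `η(2z) ^ 12` of weight `6` for `Γ₀(4)`, up to a nonzero scalar. -/
noncomputable def CuspForm.etaTwoPowTwelve : CuspForm (Gamma0 4) 6 :=
  (CuspForm.translate CuspForm.etaPowTwelve diagTwoOne).restrictLevel Gamma0_four_le_conj_Gamma_two

lemma CuspForm.etaTwoPowTwelve_ne_zero : CuspForm.etaTwoPowTwelve ≠ 0 := by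
  intro h
  have h' : _root_.etaPowTwelve ∣[(6 : ℤ)] diagTwoOne = 0 := congrArg DFunLike.coe h
  rw [SlashAction.slash_eq_zero_iff] at h'
  exact etaPowTwelve_ne_zero I (congrFun h' I)

end EtaPow

/-- the space of cusp forms of weight `6` for `Γ₀(4)` is one-dimensional
over `ℂ`. -/
theorem cuspForm_Gamma0_four_weight_six_finrank :
    Module.finrank ℂ (CuspForm (Gamma0 4) 6) = 1 := by
  refine (finrank_eq_one_iff_of_nonzero' _ CuspForm.etaTwoPowTwelve_ne_zero).mpr fun f ↦ ?_
  obtain ⟨c, hc⟩ := ((CuspForm.translate f diagTwoOne⁻¹).restrictLevel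
    Gamma_two_le_conj_Gamma0_four).exists_smul_etaPowTwelve_eq
  refine ⟨c, DFunLike.coe_injective ?_⟩
  have hc' : c • etaPowTwelve = SlashAction.map (6 : ℤ) diagTwoOne⁻¹ ⇑f := hc
  have h := congrArg (SlashAction.map (6 : ℤ) diagTwoOne) hc'
  rw [← SlashAction.slash_mul, inv_mul_cancel, SlashAction.slash_one, ModularForm.smul_slash,
    sigma_diagTwoOne] at h
  exact h
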